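/- Let Ω ⊆ ℝ^d be open, ρ_1,…,ρ_m ∈ C₀(Ω), and H : M(Ω) → ℝ^m the associated measurement operator. Let f_b : ℝ^m → ℝ ∪ {+∞} be arbitrary and suppose the problem inf_{μ ∈ M(Ω)} f_b(Hμ) + ‖μ‖_TV admits a minimizer. Then it admits a minimizer of the form μ̂ = Σ_{k=1}^p d_k δ_{x_k} with p ≤ m, d ∈ ℝ^p and points x_1,…,x_p ∈ Ω. -/

import Mathlib

open MeasureTheory Filter Topology

/-- The total variation norm of a finite signed Borel measure. -/
noncomputable def tv {α : Type*} [MeasurableSpace α] (μ : SignedMeasure α) : ℝ :=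
  (μ.totalVariation Set.univ).toReal

/-- Integration of a real function against a finite signed Borel measure. -/
noncomputable def sint {α : Type*} [MeasurableSpace α] (μ : SignedMeasure α) (f : α → ℝ) : ℝ :=
  ∫ x, f x ∂μ.toJordanDecomposition.posPart - ∫ x, f x ∂μ.toJordanDecomposition.negPart

/-- The Dirac measure at `x`, as a signed measure. -/
noncomputable def sdirac {α : Type*} [MeasurableSpace α] (x : α) : SignedMeasure α :=
  (Measure.dirac x).toSignedMeasure

section LinearReduction

variable {ι E : Type*} [AddCommGroup E] [Module ℝ E]

/-- A dependent linear combination can be rewritten with one vector less, without increasing the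
`ℓ¹` norm of the coefficients. -/
theorem exists_erase_sum_smul_eq {v : ι → E} {s : Finset ι} [DecidableEq ι] (c : ι → ℝ)
    (hs : ¬ LinearIndepOn ℝ v (s : Set ι)) :
    ∃ j ∈ s, ∃ c' : ι → ℝ, ∑ i ∈ s.erase j, c' i • v i = ∑ i ∈ s, c i • v i ∧
      ∑ i ∈ s.erase j, |c' i| ≤ ∑ i ∈ s, |c i| := by
  by_cases hc : ∃ j ∈ s, c j = 0
  · obtain ⟨j, hj, hcj⟩ := hc
    refine ⟨j, hj, c, ?_, ?_⟩
    · rw [← Finset.add_sum_erase s _ hj, hcj, zero_smul, zero_add]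
    · rw [← Finset.add_sum_erase s _ hj, hcj, abs_zero, zero_add]
  push Not at hc
  obtain ⟨g, hg, hg_nonneg, i, hi, hgi⟩ : ∃ g : ι → ℝ, ∑ i ∈ s, g i • v i = 0 ∧
      0 ≤ ∑ i ∈ s, |c i| * (g i / c i) ∧ ∃ i ∈ s, g i ≠ 0 := by
    rw [linearIndepOn_finset_iff] at hs
    push Not at hs
    obtain ⟨g, hg, hgi⟩ := hs
    rcases le_total 0 (∑ i ∈ s, |c i| * (g i / c i)) with h | h
    · exact ⟨g, hg, h, hgi⟩
    · refine ⟨-g, by simp [hg], ?_, by simpa using hgi⟩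
      simpa [neg_div] using h
  obtain ⟨j, hj, hmax⟩ := s.exists_max_image (fun i => g i / c i) ⟨i, hi⟩
  have hpos : 0 < g j / c j := by
    by_contra! hle
    have hnonpos : ∀ k ∈ s, |c k| * (g k / c k) ≤ 0 := fun k hk =>
      mul_nonpos_of_nonneg_of_nonpos (abs_nonneg _) ((hmax k hk).trans hle)
    have hzero := (Finset.sum_eq_zero_iff_of_nonpos hnonpos).1
      (le_antisymm (Finset.sum_nonpos hnonpos) hg_nonneg) i hi
    simp [hc i hi, hgi] at hzero
  set r := g j / c j with hr
  have hcoef : ∀ k ∈ s, c k - g k / r = c k * (1 - g k / c k / r) := fun k hk => by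
    have := hc k hk
    field_simp
  have hj0 : c j - g j / r = 0 := by rw [hcoef j hj, ← hr, div_self hpos.ne']; simp
  refine ⟨j, hj, fun k => c k - g k / r, ?_, ?_⟩
  · have hsum : ∑ k ∈ s, (c k - g k / r) • v k = ∑ k ∈ s, c k • v k := by
      simp only [sub_smul, Finset.sum_sub_distrib, div_eq_inv_mul, mul_smul, ← Finset.smul_sum, hg]
      simp
    rw [← hsum, ← Finset.add_sum_erase s _ hj, hj0, zero_smul, zero_add]
  · have habs : ∑ k ∈ s, |c k - g k / r| = ∑ k ∈ s, |c k| - (∑ k ∈ s, |c k| * (g k / c k)) / r := by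
      rw [Finset.sum_div, ← Finset.sum_sub_distrib]
      refine Finset.sum_congr rfl fun k hk => ?_
      have hle : g k / c k / r ≤ 1 := (div_le_one hpos).2 (hmax k hk)
      rw [hcoef k hk, abs_mul, abs_of_nonneg (sub_nonneg.2 hle)]
      ring
    have hle : ∑ k ∈ s, |c k - g k / r| ≤ ∑ k ∈ s, |c k| := by
      rw [habs]
      exact sub_le_self _ (div_nonneg hg_nonneg hpos.le)
    rwa [← Finset.add_sum_erase s _ hj, hj0, abs_zero, zero_add] at hle

theorem exists_linearIndepOn_sum_smul_eq (v : ι → E) (s : Finset ι) (c : ι → ℝ) :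
    ∃ (t : Finset ι) (c' : ι → ℝ), LinearIndepOn ℝ v (t : Set ι) ∧
      ∑ i ∈ t, c' i • v i = ∑ i ∈ s, c i • v i ∧ ∑ i ∈ t, |c' i| ≤ ∑ i ∈ s, |c i| := by
  classical
  induction s using Finset.strongInduction generalizing c with
  | H s ih =>
    by_cases hs : LinearIndepOn ℝ v (s : Set ι)
    · exact ⟨s, c, hs, rfl, le_rfl⟩
    · obtain ⟨j, hj, c₁, hsum₁, habs₁⟩ := exists_erase_sum_smul_eq c hs
      obtain ⟨t, c₂, ht, hsum₂, habs₂⟩ := ih _ (Finset.erase_ssubset hj) c₁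
      exact ⟨t, c₂, ht, hsum₂.trans hsum₁, habs₂.trans habs₁⟩

/-- Carathéodory-type reduction: a linear combination can be rewritten with at most `finrank ℝ E`
nonzero vectors, without increasing the `ℓ¹` norm of the coefficients. -/
theorem exists_fin_sum_smul_eq [FiniteDimensional ℝ E] [Fintype ι] (v : ι → E) (c : ι → ℝ) :
    ∃ p ≤ Module.finrank ℝ E, ∃ (c' : Fin p → ℝ) (k : Fin p → ι),
      ∑ j, c' j • v (k j) = ∑ i, c i • v i ∧ ∑ j, |c' j| ≤ ∑ i, |c i| ∧ ∀ j, v (k j) ≠ 0 := by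
  obtain ⟨t, c', ht, hsum, habs⟩ := exists_linearIndepOn_sum_smul_eq v Finset.univ c
  have hli : LinearIndependent ℝ fun i : t => v i := ht
  have e := t.equivFin.symm
  refine ⟨t.card, by simpa using hli.fintype_card_le_finrank, fun j => c' (e j),
    fun j => (e j : ι), ?_, ?_, fun j => hli.ne_zero (e j)⟩
  · rw [← hsum, e.sum_comp (fun i : t => c' i • v i), Finset.sum_coe_sort t fun i => c' i • v i]
  · rwa [e.sum_comp (fun i : t => |c' i|), Finset.sum_coe_sort t fun i => |c' i|]

end LinearReduction

section AtomicBall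

variable {E : Type*} [NormedAddCommGroup E] [NormedSpace ℝ E]

/-- The combinations of at most `finrank ℝ E` elements of `K` with coefficients of `ℓ¹` norm at
most one. -/
def atomicBall (K : Set E) : Set E :=
  ⋃ p ∈ Set.Iic (Module.finrank ℝ E), (fun q : (Fin p → ℝ) × (Fin p → E) => ∑ j, q.1 j • q.2 j) ''
    ({c | ∑ j, |c j| ≤ 1} ×ˢ Set.univ.pi fun _ => K)

theorem mem_atomicBall {K : Set E} {y : E} :
    y ∈ atomicBall K ↔ ∃ p ≤ Module.finrank ℝ E, ∃ (c : Fin p → ℝ) (z : Fin p → E),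
      (∀ j, z j ∈ K) ∧ ∑ j, |c j| ≤ 1 ∧ ∑ j, c j • z j = y := by
  simp only [atomicBall, Set.mem_iUnion, Set.mem_image, Set.mem_prod, Prod.exists, Set.mem_Iic,
    Set.mem_ofPred_eq, Set.mem_univ_pi, exists_prop]
  refine exists_congr fun p => and_congr_right fun _ => exists_congr fun c => exists_congr fun z => ?_
  tauto

theorem zero_mem_atomicBall (K : Set E) : (0 : E) ∈ atomicBall K :=
  mem_atomicBall.2 ⟨0, Nat.zero_le _, 0, 0, fun j => j.elim0, by simp, by simp⟩

theorem isCompact_atomicBall {K : Set E} (hK : IsCompact K) : IsCompact (atomicBall K) := by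
  refine (Set.finite_Iic _).isCompact_biUnion fun p _ => IsCompact.image ?_ (by fun_prop)
  refine IsCompact.prod ?_ (isCompact_univ_pi fun _ => hK)
  refine Metric.isCompact_of_isClosed_isBounded (isClosed_le (by fun_prop) continuous_const) ?_
  refine (Metric.isBounded_closedBall (x := (0 : Fin p → ℝ)) (r := 1)).subset fun c hc => ?_
  rw [mem_closedBall_zero_iff, pi_norm_le_iff_of_nonneg zero_le_one]
  exact fun j => (Finset.single_le_sum (f := fun j => |c j|) (fun _ _ => abs_nonneg _)
    (Finset.mem_univ j)).trans hc

variable [FiniteDimensional ℝ E]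

theorem sum_smul_mem_atomicBall {K : Set E} {ι : Type*} [Fintype ι] {c : ι → ℝ} {z : ι → E}
    (hz : ∀ i, z i ∈ K) (hc : ∑ i, |c i| ≤ 1) : ∑ i, c i • z i ∈ atomicBall K := by
  obtain ⟨p, hp, c', k, hsum, habs, -⟩ := exists_fin_sum_smul_eq z c
  exact mem_atomicBall.2 ⟨p, hp, c', fun j => z (k j), fun j => hz _, habs.trans hc, hsum⟩

theorem subset_atomicBall (K : Set E) : K ⊆ atomicBall K := fun z hz => by
  simpa using sum_smul_mem_atomicBall (K := K) (ι := Unit) (c := fun _ => 1) (z := fun _ => z)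
    (fun _ => hz) (by simp)

theorem convex_atomicBall (K : Set E) : Convex ℝ (atomicBall K) := by
  intro x hx y hy a b ha hb hab
  obtain ⟨p, -, c, z, hz, hc, rfl⟩ := mem_atomicBall.1 hx
  obtain ⟨q, -, c', z', hz', hc', rfl⟩ := mem_atomicBall.1 hy
  have h := sum_smul_mem_atomicBall (K := K) (c := Sum.elim (a • c) (b • c')) (z := Sum.elim z z')
    (by rintro (i | i) <;> simp [hz, hz']) (by
      simp only [Fintype.sum_sum_type, Sum.elim_inl, Sum.elim_inr, Pi.smul_apply, smul_eq_mul,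
        abs_mul, abs_of_nonneg ha, abs_of_nonneg hb, ← Finset.mul_sum]
      nlinarith)
  simpa [Fintype.sum_sum_type, mul_smul, Finset.smul_sum] using h

theorem exists_integral_eq_smul_atomicBall {α : Type*} [MeasurableSpace α] {K : Set E}
    (hK : IsCompact K) (P : Measure α) [IsFiniteMeasure P] {φ : α → E} (hφ : ∀ x, φ x ∈ K)
    (hi : Integrable φ P) : ∃ y ∈ atomicBall K, ∫ x, φ x ∂P = P.real Set.univ • y := by
  rcases eq_or_ne P 0 with rfl | hP
  · exact ⟨0, zero_mem_atomicBall K, by simp⟩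
  · have : NeZero P := ⟨hP⟩
    exact ⟨⨍ x, φ x ∂P, (convex_atomicBall K).average_mem (isCompact_atomicBall hK).isClosed
      (Eventually.of_forall fun x => subset_atomicBall K (hφ x)) hi, (measure_smul_average P φ).symm⟩

/-- The difference of two integrals of a function with values in a compact set `K` is a combination
of at most `finrank ℝ E` nonzero elements of `K`, with coefficients controlled by the masses. -/
theorem exists_sum_smul_eq_integral_sub_integral {α : Type*} [MeasurableSpace α] {K : Set E}
    (hK : IsCompact K) (P N : Measure α) [IsFiniteMeasure P] [IsFiniteMeasure N] {φ : α → E}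
    (hφ : ∀ x, φ x ∈ K) (hP : Integrable φ P) (hN : Integrable φ N) :
    ∃ p ≤ Module.finrank ℝ E, ∃ (c : Fin p → ℝ) (z : Fin p → E), (∀ j, z j ∈ K ∧ z j ≠ 0) ∧
      ∑ j, |c j| ≤ P.real Set.univ + N.real Set.univ ∧
      ∑ j, c j • z j = ∫ x, φ x ∂P - ∫ x, φ x ∂N := by
  obtain ⟨y, hy, hPy⟩ := exists_integral_eq_smul_atomicBall hK P hφ hP
  obtain ⟨y', hy', hNy⟩ := exists_integral_eq_smul_atomicBall hK N hφ hN
  obtain ⟨q, -, c, z, hz, hc, rfl⟩ := mem_atomicBall.1 hy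
  obtain ⟨q', -, c', z', hz', hc', rfl⟩ := mem_atomicBall.1 hy'
  obtain ⟨p, hp, e, k, hsum, habs, hne⟩ := exists_fin_sum_smul_eq (Sum.elim z z')
    (Sum.elim (P.real Set.univ • c) (-(N.real Set.univ • c')))
  refine ⟨p, hp, e, fun j => Sum.elim z z' (k j), fun j => ⟨?_, hne j⟩, habs.trans ?_, ?_⟩
  · exact Sum.rec (motive := fun i => Sum.elim z z' i ∈ K) hz hz' (k j)
  · simp only [Fintype.sum_sum_type, Sum.elim_inl, Sum.elim_inr, Pi.smul_apply, Pi.neg_apply,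
      smul_eq_mul, abs_neg, abs_mul, abs_of_nonneg measureReal_nonneg, ← Finset.mul_sum]
    exact add_le_add (mul_le_of_le_one_right measureReal_nonneg hc)
      (mul_le_of_le_one_right measureReal_nonneg hc')
  · rw [hsum, hPy, hNy]
    simp [Fintype.sum_sum_type, mul_smul, Finset.smul_sum, sub_eq_add_neg]

end AtomicBall

section SignedMeasure

variable {α : Type*} [MeasurableSpace α]

theorem tv_eq (μ : SignedMeasure α) : tv μ =
    μ.toJordanDecomposition.posPart.real Set.univ +
      μ.toJordanDecomposition.negPart.real Set.univ := by
  rw [tv, SignedMeasure.totalVariation, ← measureReal_def, measureReal_add_apply]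

theorem tv_toSignedMeasure_sub_le (P N : Measure α) [IsFiniteMeasure P] [IsFiniteMeasure N] :
    tv (P.toSignedMeasure - N.toSignedMeasure) ≤ P.real Set.univ + N.real Set.univ := by
  rw [tv_eq, Measure.toJordanDecomposition_toSignedMeasure_sub]
  exact add_le_add (ENNReal.toReal_mono (measure_ne_top _ _) (Measure.sub_le _))
    (ENNReal.toReal_mono (measure_ne_top _ _) (Measure.sub_le _))

theorem sint_toSignedMeasure_sub (P N : Measure α) [IsFiniteMeasure P] [IsFiniteMeasure N]
    {f : α → ℝ} (hP : Integrable f P) (hN : Integrable f N) :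
    sint (P.toSignedMeasure - N.toSignedMeasure) f = ∫ x, f x ∂P - ∫ x, f x ∂N := by
  rw [sint, Measure.toJordanDecomposition_toSignedMeasure_sub,
    Measure.jordanDecompositionOfToSignedMeasureSub_posPart,
    Measure.jordanDecompositionOfToSignedMeasureSub_negPart, sub_eq_sub_iff_add_eq_add,
    ← integral_add_measure (hP.mono_measure Measure.sub_le) hN,
    ← integral_add_measure hP (hN.mono_measure Measure.sub_le)]
  congr 1
  rw [← Measure.toSignedMeasure_eq_toSignedMeasure_iff, Measure.toSignedMeasure_add,
    Measure.toSignedMeasure_add, ← sub_eq_sub_iff_add_eq_add]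
  exact (Measure.sub_toSignedMeasure_eq_toSignedMeasure_sub).symm

theorem real_finsetSum_apply {ι : Type*} (s : Finset ι) (P : ι → Measure α)
    [∀ i, IsFiniteMeasure (P i)] (A : Set α) : (∑ i ∈ s, P i).real A = ∑ i ∈ s, (P i).real A := by
  simp [measureReal_def, Measure.finsetSum_apply, ENNReal.toReal_sum]

theorem toSignedMeasure_finsetSum {ι : Type*} (s : Finset ι) (P : ι → Measure α)
    [∀ i, IsFiniteMeasure (P i)] :
    (∑ i ∈ s, P i).toSignedMeasure = ∑ i ∈ s, (P i).toSignedMeasure := by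
  ext A hA
  simp [Measure.toSignedMeasure_apply_measurable hA, real_finsetSum_apply]

/-- The nonnegative combination of Dirac measures with weights the positive parts of `c`. -/
noncomputable def weightedDirac {ι : Type*} [Fintype ι] (c : ι → ℝ) (x : ι → α) : Measure α :=
  ∑ i, (c i).toNNReal • Measure.dirac (x i)

variable {ι : Type*} [Fintype ι] (c : ι → ℝ) (x : ι → α)

instance : IsFiniteMeasure (weightedDirac c x) := by
  unfold weightedDirac
  infer_instance

theorem sum_smul_sdirac : ∑ i, c i • sdirac (x i) =
    (weightedDirac c x).toSignedMeasure - (weightedDirac (-c) x).toSignedMeasure := by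
  unfold weightedDirac
  rw [toSignedMeasure_finsetSum, toSignedMeasure_finsetSum, ← Finset.sum_sub_distrib]
  refine Finset.sum_congr rfl fun i _ => ?_
  rw [Measure.toSignedMeasure_smul, Measure.toSignedMeasure_smul, NNReal.smul_def, NNReal.smul_def,
    Real.coe_toNNReal', Real.coe_toNNReal', Pi.neg_apply, sdirac]
  ext A hA
  simp [hA, ← sub_mul]

theorem weightedDirac_real_univ : (weightedDirac c x).real Set.univ = ∑ i, max (c i) 0 := by
  simp [weightedDirac, real_finsetSum_apply]

theorem tv_sum_smul_sdirac_le : tv (∑ i, c i • sdirac (x i)) ≤ ∑ i, |c i| := by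
  rw [sum_smul_sdirac]
  refine (tv_toSignedMeasure_sub_le _ _).trans_eq ?_
  rw [weightedDirac_real_univ, weightedDirac_real_univ, ← Finset.sum_add_distrib]
  refine Finset.sum_congr rfl fun i _ => ?_
  simp [max_zero_add_max_neg_zero_eq_abs_self]

variable [MeasurableSingletonClass α] (f : α → ℝ)

theorem integrable_weightedDirac : Integrable f (weightedDirac c x) := by
  unfold weightedDirac
  rw [integrable_finsetSum_measure]
  exact fun i _ => (integrable_dirac (by simp)).smul_measure_nnreal

theorem integral_weightedDirac : ∫ y, f y ∂weightedDirac c x = ∑ i, max (c i) 0 * f (x i) := by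
  unfold weightedDirac
  rw [integral_finsetSum_measure fun i _ => (integrable_dirac (by simp)).smul_measure_nnreal]
  simp [integral_smul_nnreal_measure, NNReal.smul_def]

theorem sint_sum_smul_sdirac : sint (∑ i, c i • sdirac (x i)) f = ∑ i, c i * f (x i) := by
  rw [sum_smul_sdirac, sint_toSignedMeasure_sub _ _ (integrable_weightedDirac _ _ _)
    (integrable_weightedDirac _ _ _), integral_weightedDirac, integral_weightedDirac,
    ← Finset.sum_sub_distrib]
  refine Finset.sum_congr rfl fun i _ => ?_
  rw [← sub_mul, Pi.neg_apply, max_zero_sub_max_neg_zero_eq_self]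

end SignedMeasure

/-- Every finite signed measure can be replaced by a combination of at most `m` Dirac measures with
the same integrals against `ρ_1, …, ρ_m ∈ C₀(α)`, without increasing the total variation. -/
theorem exists_sum_smul_sdirac {α : Type*} [TopologicalSpace α] [MeasurableSpace α]
    [OpensMeasurableSpace α] [MeasurableSingletonClass α] {m : ℕ}
    (ρ : Fin m → ZeroAtInftyContinuousMap α ℝ) (μ : SignedMeasure α) :
    ∃ p ≤ m, ∃ (c : Fin p → ℝ) (x : Fin p → α),
      (∀ i, sint (∑ k, c k • sdirac (x k)) (fun y => ρ i y) = sint μ fun y => ρ i y) ∧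
        tv (∑ k, c k • sdirac (x k)) ≤ tv μ := by
  set φ : α → Fin m → ℝ := fun y i => ρ i y
  have hcont : Continuous φ := continuous_pi fun i => (ρ i).continuous
  have hK : IsCompact (insert 0 (Set.range φ)) :=
    Tendsto.isCompact_insert_range_of_cocompact
      (tendsto_pi_nhds.2 fun i => (ρ i).zero_at_infty') hcont
  have hint : ∀ (P : Measure α) [IsFiniteMeasure P], ∀ i, Integrable (fun y => ρ i y) P :=
    fun P _ i => BoundedContinuousFunction.integrable P (ρ i).toBCF
  obtain ⟨p, hp, c, z, hz, hc, hsum⟩ := exists_sum_smul_eq_integral_sub_integral hK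
    μ.toJordanDecomposition.posPart μ.toJordanDecomposition.negPart (φ := φ)
    (fun y => Set.mem_insert_of_mem _ ⟨y, rfl⟩)
    (Integrable.of_eval fun i => hint _ i) (Integrable.of_eval fun i => hint _ i)
  have hx : ∀ j, ∃ y, φ y = z j := fun j => (hz j).1.resolve_left (hz j).2
  choose x hx using hx
  refine ⟨p, by simpa using hp, c, x, fun i => ?_, ?_⟩
  · have h := congrFun hsum i
    rw [Pi.sub_apply, eval_integral fun i => hint _ i, eval_integral fun i => hint _ i] at h
    rw [sint_sum_smul_sdirac, sint, ← h]
    simp [← hx, φ]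
  · rw [tv_eq μ]
    exact (tv_sum_smul_sdirac_le c x).trans hc

/-- If the problem `inf_μ f_b(Hμ) + ‖μ‖_TV` over the finite signed Borel measures on an open
`Ω ⊆ ℝ^d` (with `H` the measurement operator associated with `ρ_1, …, ρ_m ∈ C₀(Ω)`) admits a
minimizer, then it admits a minimizer of the form `Σ_{k=1}^p d_k δ_{x_k}` with `p ≤ m`. -/
theorem stmt2 {d m : ℕ} (Ω : Set (Fin d → ℝ)) (hΩ : IsOpen Ω)
    (ρ : Fin m → ZeroAtInftyContinuousMap Ω ℝ)
    (H : SignedMeasure Ω → Fin m → ℝ)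
    (hH : ∀ μ i, H μ i = sint μ (fun x => ρ i x))
    (f : (Fin m → ℝ) → EReal)
    (hbot : ∀ x, f x ≠ ⊥)
    (hmin : ∃ μhat : SignedMeasure Ω, ∀ μ : SignedMeasure Ω,
      f (H μhat) + (tv μhat : EReal) ≤ f (H μ) + (tv μ : EReal)) :
    ∃ (p : ℕ) (_ : p ≤ m) (dcoef : Fin p → ℝ) (x : Fin p → Ω),
      ∀ μ : SignedMeasure Ω,
        f (H (∑ k, dcoef k • sdirac (x k))) + (tv (∑ k, dcoef k • sdirac (x k)) : EReal)
          ≤ f (H μ) + (tv μ : EReal) := by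
  obtain ⟨μhat, hμhat⟩ := hmin
  obtain ⟨p, hp, c, x, hsint, htv⟩ := exists_sum_smul_sdirac ρ μhat
  refine ⟨p, hp, c, x, fun μ => le_trans ?_ (hμhat μ)⟩
  have hHeq : H (∑ k, c k • sdirac (x k)) = H μhat := by
    ext i
    rw [hH, hH, hsint i]
  rw [hHeq]
  exact add_le_add le_rfl (EReal.coe_le_coe_iff.2 htv)
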